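/- Let G = ([n], E) be a finite simple graph and let γ be an acyclic orientation of G with source components S_1, …, S_k. Let C_γ = {x ∈ ℝ^n : x_b ≥ x_a for every edge {a,b} ∈ E that γ directs towards b} be the closed region of the graphical arrangement labeled by γ. Let v = (v_1, …, v_n) ∈ ℝ^n satisfy v_i > (6n² + 1)v_{i+1} for all 1 ≤ i < n and v_n > 0, and let p be the unique point of C_γ minimizing the Euclidean distance to v. Then for every i ∈ [n], the i-th coordinate of p equals the average (1/|S_a|)·Σ_{m ∈ S_a} v_m, where S_a is the source component containing i; moreover, p_i = p_j if and only if i and j lie in the same source component of γ. In particular, the number of distinct values among the coordinates of p, and the number of connected components of the graph ([n], {{i,j} ∈ E : p_i = p_j}), both equal k. -/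

import Mathlib

open Classical

/-- The set of vertices reachable from `i` by a directed path of `γ` (including `i`). -/
noncomputable def reachSet {n : ℕ} (γ : Fin n → Fin n → Prop) (i : Fin n) : Finset (Fin n) :=
  Finset.univ.filter fun j => Relation.ReflTransGen γ i j

/-- `scAcc γ k` is the union `S₁ ∪ ⋯ ∪ S_k` of the first `k` source components of `γ`. -/
noncomputable def scAcc {n : ℕ} (γ : Fin n → Fin n → Prop) : ℕ → Finset (Fin n)
  | 0 => ∅
  | k + 1 =>
      if h : (Finset.univ \ scAcc γ k).Nonempty then
        scAcc γ k ∪ reachSet γ ((Finset.univ \ scAcc γ k).min' h)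
      else scAcc γ k

/-- `sourceComp γ k` is the `(k+1)`-st source component `S_{k+1}` of `γ`
(so the source components of the paper are `sourceComp γ 0, sourceComp γ 1, …`). -/
noncomputable def sourceComp {n : ℕ} (γ : Fin n → Fin n → Prop) (k : ℕ) : Finset (Fin n) :=
  scAcc γ (k + 1) \ scAcc γ k

/-- The number of (nonempty) source components of `γ`. -/
noncomputable def numSourceComps {n : ℕ} (γ : Fin n → Fin n → Prop) : ℕ :=
  ((Finset.range n).filter fun k => (sourceComp γ k).Nonempty).card

section SourceComponents

variable {n : ℕ} {γ : Fin n → Fin n → Prop}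

theorem scAcc_subset_succ (k : ℕ) : scAcc γ k ⊆ scAcc γ (k + 1) := by
  rw [scAcc]
  split_ifs with h
  · exact Finset.subset_union_left
  · exact Finset.Subset.refl _

theorem scAcc_mono : Monotone (scAcc γ) :=
  monotone_nat_of_le_succ scAcc_subset_succ

/-- Each union of source components is closed under following directed edges. -/
theorem mem_scAcc_of_rel {a b : Fin n} (hab : γ a b) :
    ∀ {k : ℕ}, a ∈ scAcc γ k → b ∈ scAcc γ k
  | 0, h => by simp [scAcc] at h
  | k + 1, h => by
      rw [scAcc] at h ⊢
      split_ifs at h ⊢ with hne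
      · rcases Finset.mem_union.1 h with h | h
        · exact Finset.mem_union_left _ (mem_scAcc_of_rel hab h)
        · refine Finset.mem_union_right _ ?_
          simp only [reachSet, Finset.mem_filter, Finset.mem_univ, true_and] at h ⊢
          exact h.tail hab
      · exact mem_scAcc_of_rel hab h

theorem mem_scAcc_of_reflTransGen {a b : Fin n} {k : ℕ} (hab : Relation.ReflTransGen γ a b)
    (ha : a ∈ scAcc γ k) : b ∈ scAcc γ k := by
  induction hab with
  | refl => exact ha
  | tail _ h ih => exact mem_scAcc_of_rel h ih

theorem eq_of_mem_sourceComp {i : Fin n} {a b : ℕ} (ha : i ∈ sourceComp γ a)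
    (hb : i ∈ sourceComp γ b) : a = b := by
  simp only [sourceComp, Finset.mem_sdiff] at ha hb
  by_contra hne
  rcases lt_or_gt_of_ne hne with h | h
  · exact hb.2 (scAcc_mono (Nat.succ_le_of_lt h) ha.1)
  · exact ha.2 (scAcc_mono (Nat.succ_le_of_lt h) hb.1)

/-- A nonempty source component consists of vertices reachable from its least element, which is
also the least vertex outside of the previous components. -/
theorem exists_source {i : Fin n} {a : ℕ} (hi : i ∈ sourceComp γ a) :
    ∃ m ∈ sourceComp γ a, (∀ j ∉ scAcc γ a, m ≤ j) ∧
      ∀ j ∈ sourceComp γ a, Relation.ReflTransGen γ m j := by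
  have hne : (Finset.univ \ scAcc γ a).Nonempty :=
    ⟨i, by simpa using (Finset.mem_sdiff.1 hi).2⟩
  have hacc : scAcc γ (a + 1) =
      scAcc γ a ∪ reachSet γ ((Finset.univ \ scAcc γ a).min' hne) := by
    rw [scAcc, dif_pos hne]
  have hm := Finset.min'_mem _ hne
  have hmin : ∀ j ∉ scAcc γ a, (Finset.univ \ scAcc γ a).min' hne ≤ j := fun j hj =>
    Finset.min'_le _ _ (by simpa using hj)
  generalize (Finset.univ \ scAcc γ a).min' hne = m at hacc hm hmin
  refine ⟨m, ?_, hmin, fun j hj => ?_⟩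
  · rw [sourceComp, hacc]
    simp only [Finset.mem_sdiff, Finset.mem_univ, true_and] at hm
    simp [hm, reachSet, Relation.ReflTransGen.refl]
  · rw [sourceComp, hacc] at hj
    simp only [Finset.mem_sdiff, Finset.mem_union, reachSet, Finset.mem_filter,
      Finset.mem_univ, true_and] at hj
    exact hj.1.resolve_left hj.2

theorem scAcc_eq_univ_or_le_card (k : ℕ) :
    scAcc γ k = Finset.univ ∨ k ≤ (scAcc γ k).card := by
  induction k with
  | zero => exact Or.inr (Nat.zero_le _)
  | succ k ih =>
    by_cases hne : (Finset.univ \ scAcc γ k).Nonempty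
    · right
      have hk : k ≤ (scAcc γ k).card := by
        refine ih.resolve_left fun h => ?_
        simp [h] at hne
      refine Nat.succ_le_of_lt (hk.trans_lt (Finset.card_lt_card ?_))
      refine Finset.ssubset_iff_subset_ne.2 ⟨scAcc_subset_succ k, fun h => ?_⟩
      have hm := Finset.min'_mem _ hne
      refine (Finset.mem_sdiff.1 hm).2 (h.ge ?_)
      rw [scAcc, dif_pos hne]
      exact Finset.mem_union_right _ (by simp [reachSet, Relation.ReflTransGen.refl])
    · left
      rw [Finset.not_nonempty_iff_eq_empty, Finset.sdiff_eq_empty_iff_subset] at hne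
      exact Finset.univ_subset_iff.1 (hne.trans (scAcc_subset_succ k))

theorem scAcc_self_eq_univ : scAcc γ n = Finset.univ := by
  rcases scAcc_eq_univ_or_le_card (γ := γ) n with h | h
  · exact h
  · exact Finset.eq_univ_of_card _ (le_antisymm (Finset.card_le_univ _) (by simpa using h))

theorem exists_mem_sourceComp_of_mem_scAcc {i : Fin n} {k : ℕ} (hi : i ∈ scAcc γ k) :
    ∃ a < k, i ∈ sourceComp γ a := by
  induction k with
  | zero => simp [scAcc] at hi
  | succ k ih =>
    by_cases h : i ∈ scAcc γ k
    · obtain ⟨a, ha, hia⟩ := ih h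
      exact ⟨a, ha.trans k.lt_succ_self, hia⟩
    · exact ⟨k, k.lt_succ_self, Finset.mem_sdiff.2 ⟨hi, h⟩⟩

theorem exists_mem_sourceComp (γ : Fin n → Fin n → Prop) (i : Fin n) :
    ∃ a < n, i ∈ sourceComp γ a :=
  exists_mem_sourceComp_of_mem_scAcc (by simp [scAcc_self_eq_univ])

/-- A directed path ending in a source component and starting outside of the previous ones
can be traversed inside any relation containing the edges of `γ` within the component. -/
theorem reflTransGen_restrict_sourceComp {m j : Fin n} {a : ℕ} (hm : m ∈ sourceComp γ a)
    (hmj : Relation.ReflTransGen γ m j) (hj : j ∈ sourceComp γ a) :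
    Relation.ReflTransGen
      (fun x y => γ x y ∧ x ∈ sourceComp γ a ∧ y ∈ sourceComp γ a) m j := by
  induction hmj with
  | refl => exact .refl
  | @tail x y hmx hxy ih =>
    have hx : x ∈ sourceComp γ a := by
      refine Finset.mem_sdiff.2
        ⟨mem_scAcc_of_reflTransGen hmx (Finset.mem_sdiff.1 hm).1, fun h => ?_⟩
      exact (Finset.mem_sdiff.1 hj).2 (mem_scAcc_of_rel hxy h)
    exact (ih hx).tail ⟨hxy, hx, hj⟩

end SourceComponents

section Average

variable {n : ℕ} {v : Fin n → ℝ}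

theorem lt_average_of_lt (hpos : ∀ i, 0 < v i) (hgap : ∀ i j, i < j → n * v j < v i)
    {S : Finset (Fin n)} {m j : Fin n} (hm : m ∈ S) (hmj : m < j) :
    v j < (∑ i ∈ S, v i) / (S.card : ℝ) := by
  have hcard : (0 : ℝ) < S.card := by exact_mod_cast Finset.card_pos.2 ⟨m, hm⟩
  have hle : (S.card : ℝ) ≤ n := by exact_mod_cast card_finset_fin_le S
  rw [lt_div_iff₀ hcard]
  calc v j * S.card ≤ n * v j := by nlinarith [hpos j]
    _ < v m := hgap m j hmj
    _ ≤ ∑ i ∈ S, v i := Finset.single_le_sum (fun i _ => (hpos i).le) hm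

theorem average_le {S : Finset (Fin n)} {m : Fin n} (hm : m ∈ S) (h : ∀ i ∈ S, v i ≤ v m) :
    (∑ i ∈ S, v i) / (S.card : ℝ) ≤ v m := by
  have hcard : (0 : ℝ) < S.card := by exact_mod_cast Finset.card_pos.2 ⟨m, hm⟩
  rw [div_le_iff₀ hcard, mul_comm, ← nsmul_eq_mul]
  exact Finset.sum_le_card_nsmul _ _ _ h

/-- The variational inequality for projecting onto the constants on `S`, among vectors attaining
their minimum over `S` at `m`. -/
theorem sum_sub_average_mul_nonpos {S : Finset (Fin n)} {m : Fin n} (hm : m ∈ S)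
    (hlt : ∀ i ∈ S, i ≠ m → v i ≤ (∑ i ∈ S, v i) / (S.card : ℝ)) {x : Fin n → ℝ}
    (hx : ∀ i ∈ S, x m ≤ x i) (c : ℝ) :
    ∑ i ∈ S, (v i - (∑ i ∈ S, v i) / (S.card : ℝ)) * (x i - c) ≤ 0 := by
  have hcard : (S.card : ℝ) ≠ 0 := by exact_mod_cast (Finset.card_pos.2 ⟨m, hm⟩).ne'
  set A := (∑ i ∈ S, v i) / (S.card : ℝ) with hA
  have hzero : ∑ i ∈ S, (v i - A) = 0 := by
    rw [Finset.sum_sub_distrib, Finset.sum_const, nsmul_eq_mul, hA]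
    field_simp
    ring
  have hsplit : ∑ i ∈ S, (v i - A) * (x i - c) =
      ∑ i ∈ S, (v i - A) * (x i - x m) + (∑ i ∈ S, (v i - A)) * (x m - c) := by
    rw [Finset.sum_mul, ← Finset.sum_add_distrib]
    exact Finset.sum_congr rfl fun i _ => by ring
  rw [hsplit, hzero, zero_mul, add_zero]
  refine Finset.sum_nonpos fun i hi => ?_
  by_cases him : i = m
  · simp [him]
  · exact mul_nonpos_of_nonpos_of_nonneg (sub_nonpos.2 (hlt i hi him)) (sub_nonneg.2 (hx i hi))

theorem average_sourceComp_lt {γ : Fin n → Fin n → Prop} (hpos : ∀ i, 0 < v i)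
    (hgap : ∀ i j, i < j → n * v j < v i) (hanti : Antitone v) {i j : Fin n} {a b : ℕ}
    (hi : i ∈ sourceComp γ a) (hj : j ∈ sourceComp γ b) (hab : a < b) :
    (∑ m ∈ sourceComp γ b, v m) / ((sourceComp γ b).card : ℝ) <
      (∑ m ∈ sourceComp γ a, v m) / ((sourceComp γ a).card : ℝ) := by
  obtain ⟨s, hs, hsmin, -⟩ := exists_source hi
  obtain ⟨t, ht, htmin, -⟩ := exists_source hj
  have hta : t ∉ scAcc γ (a + 1) := fun h =>
    (Finset.mem_sdiff.1 ht).2 (scAcc_mono (Nat.succ_le_of_lt hab) h)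
  have hst : s < t := by
    refine lt_of_le_of_ne (hsmin t fun h => hta (scAcc_subset_succ a h)) ?_
    rintro rfl
    exact hta (Finset.mem_sdiff.1 hs).1
  exact (average_le ht fun k hk => hanti (htmin k (Finset.mem_sdiff.1 hk).2)).trans_lt
    (lt_average_of_lt hpos hgap hs hst)

end Average

/-- A vector at least as close to `v` as `y` and satisfying the variational inequality at `y`
equals `y`. -/
theorem eq_of_dist_le_of_sum_mul_nonpos {ι : Type*} [Fintype ι] {v y p : EuclideanSpace ℝ ι}
    (hd : dist v p ≤ dist v y) (h : ∑ i, (v i - y i) * (p i - y i) ≤ 0) (i : ι) :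
    p i = y i := by
  rw [EuclideanSpace.dist_eq, EuclideanSpace.dist_eq,
    Real.sqrt_le_sqrt_iff (Finset.sum_nonneg fun _ _ => sq_nonneg _)] at hd
  simp only [Real.dist_eq, sq_abs] at hd
  have hexp : ∑ i, (v i - p i) ^ 2 = ∑ i, (v i - y i) ^ 2 -
      2 * ∑ i, (v i - y i) * (p i - y i) + ∑ i, (p i - y i) ^ 2 := by
    rw [Finset.mul_sum, ← Finset.sum_sub_distrib, ← Finset.sum_add_distrib]
    exact Finset.sum_congr rfl fun i _ => by ring
  have hi := Finset.single_le_sum (f := fun i => (p i - y i) ^ 2) (fun _ _ => sq_nonneg _)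
    (Finset.mem_univ i)
  have hsq : (p i - y i) ^ 2 = 0 :=
    le_antisymm (hi.trans (by linarith)) (sq_nonneg _)
  exact sub_eq_zero.1 (pow_eq_zero_iff two_ne_zero |>.1 hsq)

/-- If reachability in `H` is equality of `f`-values, the connected components of `H` are counted
by the values of `f`. -/
theorem card_connectedComponent_eq_card_image {V α : Type*} [Fintype V] [DecidableEq α]
    (H : SimpleGraph V) (f : V → α) (h : ∀ i j, H.Reachable i j ↔ f i = f j) :
    Nat.card H.ConnectedComponent = (Finset.univ.image f).card := by
  have e : H.ConnectedComponent ≃ Set.range f :=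
    (Quot.congrRight h).trans (Setoid.quotientKerEquivRange f)
  rw [Nat.card_congr e, Nat.card_coe_set_eq, ← Set.ncard_coe_finset]
  simp

theorem pos_of_superincreasing {n : ℕ} {v : Fin n → ℝ} (hn : 1 ≤ n) {c : ℝ} (hc : 0 ≤ c)
    (hv : ∀ i : ℕ, ∀ h : i + 1 < n, c * v ⟨i + 1, h⟩ < v ⟨i, by omega⟩)
    (hvn : 0 < v ⟨n - 1, by omega⟩) (i : Fin n) : 0 < v i := by
  suffices h : ∀ d : ℕ, ∀ i : Fin n, (i : ℕ) + d = n - 1 → 0 < v i from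
    h (n - 1 - i) i (by omega)
  intro d
  induction d with
  | zero =>
    intro i hi
    have : i = ⟨n - 1, by omega⟩ := Fin.ext hi
    rwa [this]
  | succ d ih =>
    intro i hi
    exact (mul_nonneg hc (ih ⟨i + 1, by omega⟩ (by simp only; omega)).le).trans_lt
      (hv i (by omega))

theorem mul_lt_of_superincreasing {n : ℕ} {v : Fin n → ℝ} {c : ℝ} (hc : 1 ≤ c)
    (hpos : ∀ i, 0 < v i)
    (hv : ∀ i : ℕ, ∀ h : i + 1 < n, c * v ⟨i + 1, h⟩ < v ⟨i, by omega⟩)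
    {i j : Fin n} (hij : i < j) : c * v j < v i := by
  suffices h : ∀ d : ℕ, ∀ i j : Fin n, (i : ℕ) + d + 1 = j → c * v j < v i from
    h (j - i - 1) i j (by omega)
  intro d
  induction d with
  | zero =>
    rintro i ⟨j, hj⟩ rfl
    exact hv i hj
  | succ d ih =>
    intro i j hj
    have h1 := ih ⟨i + 1, by omega⟩ j (by simp only; omega)
    have h2 := hv i (by omega)
    nlinarith [hpos ⟨i + 1, by omega⟩]

/-- For generic `v` (Equation vec2), the nearest point `p` of the closed
region of the graphical arrangement labeled by an acyclic orientation `γ` has coordinates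
given by averaging `v` over the source components of `γ`; coordinates agree exactly on
source components; and both the number of distinct coordinate values of `p` and the number
of connected components of the edge subgraph `{e ∈ E : p` constant on `e}` equal the
number `k` of source components. -/
theorem graphical_projection_source_components {n : ℕ} (hn : 1 ≤ n)
    (G : SimpleGraph (Fin n)) (γ : Fin n → Fin n → Prop)
    (hor : ∀ a b, γ a b → G.Adj a b)
    (hone : ∀ a b, G.Adj a b → (γ a b ↔ ¬ γ b a))
    (hacyc : ∀ a, ¬ Relation.TransGen γ a a)
    (k : ℕ) (hk : numSourceComps γ = k)
    (v : EuclideanSpace ℝ (Fin n))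
    (hv : ∀ i : ℕ, ∀ h : i + 1 < n, (6 * (n : ℝ) ^ 2 + 1) * v ⟨i + 1, h⟩ < v ⟨i, by omega⟩)
    (hvn : 0 < v ⟨n - 1, by omega⟩)
    (p : EuclideanSpace ℝ (Fin n))
    (hp : ∀ a b : Fin n, γ a b → p a ≤ p b)
    (hmin : ∀ x : EuclideanSpace ℝ (Fin n),
      (∀ a b : Fin n, γ a b → x a ≤ x b) → dist v p ≤ dist v x) :
    (∀ (i : Fin n) (a : ℕ), i ∈ sourceComp γ a →
        p i = (∑ m ∈ sourceComp γ a, v m) / ((sourceComp γ a).card : ℝ)) ∧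
    (∀ i j : Fin n, p i = p j ↔ ∃ a : ℕ, i ∈ sourceComp γ a ∧ j ∈ sourceComp γ a) ∧
    (Finset.univ.image fun i : Fin n => p i).card = k ∧
    Nat.card (SimpleGraph.fromRel fun i j : Fin n => G.Adj i j ∧ p i = p j).ConnectedComponent
      = k := by
  have hn2 : (0 : ℝ) ≤ (n : ℝ) ^ 2 := sq_nonneg _
  have hpos : ∀ i, 0 < v i := pos_of_superincreasing hn (by positivity) hv hvn
  have hlt : ∀ i j : Fin n, i < j → (6 * (n : ℝ) ^ 2 + 1) * v j < v i := fun i j hij =>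
    mul_lt_of_superincreasing (v := v) (by linarith) hpos hv hij
  have hgap : ∀ i j : Fin n, i < j → n * v j < v i := fun i j hij =>
    (mul_le_mul_of_nonneg_right (by nlinarith [sq_nonneg ((n : ℝ) - 1)]) (hpos j).le).trans_lt
      (hlt i j hij)
  have hanti : Antitone fun i => v i := by
    refine antitone_iff_forall_lt.2 fun i j hij => ?_
    nlinarith [hlt i j hij, mul_nonneg hn2 (hpos j).le]
  choose c hcn hc using exists_mem_sourceComp γ
  have hceq : ∀ {i : Fin n} {a : ℕ}, i ∈ sourceComp γ a ↔ c i = a := fun {i a} =>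
    ⟨fun h => eq_of_mem_sourceComp (hc i) h, fun h => h ▸ hc i⟩
  set avg : ℕ → ℝ := fun a =>
    (∑ m ∈ sourceComp γ a, v m) / ((sourceComp γ a).card : ℝ) with havg
  have havg_lt : ∀ i j : Fin n, c i < c j → avg (c j) < avg (c i) := fun i j h =>
    average_sourceComp_lt hpos hgap hanti (hc i) (hc j) h
  have havg_inj : ∀ i j : Fin n, avg (c i) = avg (c j) ↔ c i = c j := by
    refine fun i j => ⟨fun h => ?_, fun h => by rw [h]⟩
    by_contra hne
    rcases lt_or_gt_of_ne hne with h' | h'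
    · exact (havg_lt i j h').ne' h
    · exact (havg_lt j i h').ne h
  have hdesc : ∀ i j : Fin n, γ i j → c j ≤ c i := fun i j hij => by
    by_contra! h
    exact (Finset.mem_sdiff.1 (hc j)).2 (scAcc_mono (Nat.succ_le_of_lt h)
      (mem_scAcc_of_rel hij (Finset.mem_sdiff.1 (hc i)).1))
  have hreach : ∀ i j : Fin n, Relation.ReflTransGen γ i j → p i ≤ p j := fun i j h => by
    induction h with
    | refl => exact le_rfl
    | tail _ h ih => exact ih.trans (hp _ _ h)
  have hpc : ∀ i, p i = avg (c i) := by
    refine eq_of_dist_le_of_sum_mul_nonpos (y := WithLp.toLp 2 fun i => avg (c i))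
      (hmin _ fun i j hij => ?_) ?_
    · rcases (hdesc i j hij).lt_or_eq with h | h
      · exact (havg_lt j i h).le
      · exact ((havg_inj i j).2 h.symm).le
    · change ∑ i, (v i - avg (c i)) * (p i - avg (c i)) ≤ 0
      rw [← Finset.sum_fiberwise_of_maps_to (t := Finset.range n) (g := c)
        fun i _ => Finset.mem_range.2 (hcn i)]
      refine Finset.sum_nonpos fun a _ => ?_
      have hfib : (Finset.univ.filter fun i => c i = a) = sourceComp γ a := by
        ext i
        simp [hceq]
      rw [hfib]
      rcases (sourceComp γ a).eq_empty_or_nonempty with he | ⟨i, hi⟩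
      · simp [he]
      obtain ⟨m, hm, hmin', hmr⟩ := exists_source hi
      rw [Finset.sum_congr rfl fun i hi =>
        show _ = (v i - avg a) * (p i - avg a) by rw [hceq.1 hi]]
      refine sum_sub_average_mul_nonpos hm (fun j hj hjm => ?_)
        (fun j hj => hreach m j (hmr j hj)) _
      exact (lt_average_of_lt hpos hgap hm
        (lt_of_le_of_ne (hmin' j (Finset.mem_sdiff.1 hj).2) (Ne.symm hjm))).le
  have hiff : ∀ i j, p i = p j ↔ c i = c j := fun i j => by
    rw [hpc, hpc, havg_inj]
  have himage : (Finset.univ.image fun i : Fin n => p i).card = k := by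
    have hidx : Finset.univ.image c =
        (Finset.range n).filter fun a => (sourceComp γ a).Nonempty := by
      ext a
      simp only [Finset.mem_image, Finset.mem_univ, true_and, Finset.mem_filter,
        Finset.mem_range]
      constructor
      · rintro ⟨i, rfl⟩
        exact ⟨hcn i, i, hc i⟩
      · rintro ⟨-, i, hi⟩
        exact ⟨i, hceq.1 hi⟩
    have hcomp : (Finset.univ.image fun i : Fin n => p i) = (Finset.univ.image c).image avg := by
      rw [Finset.image_image]
      exact Finset.image_congr fun i _ => hpc i
    rw [hcomp, Finset.card_image_of_injOn, hidx, ← hk, numSourceComps]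
    intro a ha b hb hab
    simp only [Finset.coe_image, Finset.coe_univ, Set.image_univ, Set.mem_range] at ha hb
    obtain ⟨i, rfl⟩ := ha
    obtain ⟨j, rfl⟩ := hb
    exact (havg_inj i j).1 hab
  refine ⟨fun i a hi => by rw [hpc, hceq.1 hi], fun i j => ?_, himage, ?_⟩
  · rw [hiff]
    exact ⟨fun h => ⟨c j, hceq.2 h, hc j⟩, fun ⟨a, hi, hj⟩ => (hceq.1 hi).trans (hceq.1 hj).symm⟩
  · rw [← himage]
    refine card_connectedComponent_eq_card_image _ _ fun i j => ⟨fun h => ?_, fun h => ?_⟩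
    · rw [SimpleGraph.reachable_iff_reflTransGen] at h
      induction h with
      | refl => rfl
      | tail _ h ih =>
        rw [SimpleGraph.fromRel_adj] at h
        exact ih.trans (h.2.elim And.right fun h => h.2.symm)
    · obtain ⟨m, hm, -, hmr⟩ := exists_source (hc i)
      have key : ∀ x ∈ sourceComp γ (c i), (SimpleGraph.fromRel
          fun i j : Fin n => G.Adj i j ∧ p i = p j).Reachable m x := fun x hx => by
        rw [SimpleGraph.reachable_iff_reflTransGen]
        refine Relation.ReflTransGen.mono ?_ _ _
          (reflTransGen_restrict_sourceComp hm (hmr x hx) hx)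
        rintro y z ⟨hyz, hy, hz⟩
        rw [SimpleGraph.fromRel_adj]
        exact ⟨(hor y z hyz).ne, Or.inl
          ⟨hor y z hyz, (hiff y z).2 ((hceq.1 hy).trans (hceq.1 hz).symm)⟩⟩
      exact (key i (hc i)).symm.trans (key j (hceq.2 ((hiff i j).1 h).symm))
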